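/- For any tree T with at least four vertices, μ(T) ≤ μ'(T), with equality if and only if T is isomorphic to the path on four vertices P₄. -/

import Mathlib

open SimpleGraph Finset BigOperators Filter

attribute [local instance] Classical.propDecidable

/-- A finset of vertices induces a subtree of `G`: it is nonempty and its induced
subgraph is connected. -/
def SimpleGraph.IsSubtree {V : Type*} (G : SimpleGraph V) (s : Finset V) : Prop :=
  s.Nonempty ∧ (G.induce (s : Set V)).Connected

/-- The collection of all subtrees of `G` (as finsets of vertices). -/
noncomputable def subtreeFinset {V : Type*} [Fintype V] (G : SimpleGraph V) :
    Finset (Finset V) :=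
  Finset.univ.filter G.IsSubtree

/-- `μ(G)`: the average order (number of vertices) of a subtree of `G`. -/
noncomputable def mu {V : Type*} [Fintype V] (G : SimpleGraph V) : ℚ :=
  (∑ s ∈ subtreeFinset G, (s.card : ℚ)) / ((subtreeFinset G).card : ℚ)

/-- `𝒮'(G)`: the collection obtained from the collection of subtrees of `G` by
adding the empty set and removing the singleton `{v}` for every leaf `v`. -/
noncomputable def subtreeFinset' {V : Type*} [Fintype V] (G : SimpleGraph V) :
    Finset (Finset V) :=
  insert ∅ ((subtreeFinset G).filter (fun s => ¬ ∃ v, G.degree v = 1 ∧ s = {v}))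

/-- `μ'(G)`: the average cardinality of a member of `𝒮'(G)`. -/
noncomputable def mu' {V : Type*} [Fintype V] (G : SimpleGraph V) : ℚ :=
  (∑ s ∈ subtreeFinset' G, (s.card : ℚ)) / ((subtreeFinset' G).card : ℚ)

namespace SimpleGraph

variable {V : Type*} {G : SimpleGraph V}

/-- In an acyclic graph, deleting a vertex of degree at least two leaves two of its
neighbours disconnected. -/
lemma IsAcyclic.eq_of_adj_of_connected_induce_compl (hG : G.IsAcyclic) {v x y : V}
    (hv : (G.induce {v}ᶜ).Preconnected) (hx : G.Adj v x) (hy : G.Adj v y) : x = y := by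
  by_contra hxy
  have hbridge := isAcyclic_iff_forall_adj_isBridge.mp hG hx
  rw [isBridge_iff] at hbridge
  have hvy : (G.deleteEdges {s(v, x)}).Adj v y := by
    rw [deleteEdges_adj]
    refine ⟨hy, fun h => hxy ?_⟩
    have h' : s(v, y) = s(v, x) := h
    exact (Sym2.congr_right.mp h').symm
  let f : G.induce {v}ᶜ →g G.deleteEdges {s(v, x)} :=
    { toFun := fun w => w
      map_rel' := by
        rintro ⟨p, hp⟩ ⟨q, hq⟩ hpq
        rw [deleteEdges_adj]
        refine ⟨hpq, fun h => ?_⟩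
        have h' : s(p, q) = s(v, x) := h
        simp only [Set.mem_compl_iff, Set.mem_singleton_iff] at hp hq
        simp only [Sym2.eq_iff] at h'
        tauto }
  exact hbridge (hvy.reachable.trans
    ((hv ⟨y, hy.ne'⟩ ⟨x, hx.ne'⟩).map f))

lemma isSubtree_singleton (v : V) : G.IsSubtree {v} := by
  refine ⟨singleton_nonempty v, ?_⟩
  rw [coe_singleton]
  exact Connected.of_subsingleton

variable [Fintype V]

/-- The set of vertices of degree one. -/
noncomputable def leafFinset (G : SimpleGraph V) : Finset V :=
  univ.filter fun v => G.degree v = 1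

lemma mem_leafFinset {v : V} : v ∈ G.leafFinset ↔ G.degree v = 1 := by
  simp [leafFinset]

lemma Connected.isSubtree_univ (hG : G.Connected) : G.IsSubtree univ := by
  have := hG.nonempty
  refine ⟨univ_nonempty, ?_⟩
  rw [coe_univ]
  exact (induceUnivIso G).connected_iff.mpr hG

lemma IsTree.isSubtree_compl_singleton_iff (hG : G.IsTree) (hn : 2 ≤ Fintype.card V) {v : V} :
    G.IsSubtree {v}ᶜ ↔ v ∈ G.leafFinset := by
  have : Nontrivial V := Fintype.one_lt_card_iff_nontrivial.mp hn
  rw [mem_leafFinset]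
  constructor
  · rintro ⟨-, h⟩
    rw [coe_compl, coe_singleton] at h
    obtain ⟨x, hx⟩ := hG.connected.preconnected.exists_adj_of_nontrivial v
    exact degree_eq_one_iff_existsUnique_adj.mpr ⟨x, hx, fun y hy =>
      hG.isAcyclic.eq_of_adj_of_connected_induce_compl h.preconnected hy hx⟩
  · intro h
    refine ⟨?_, ?_⟩
    · obtain ⟨w, hw⟩ := exists_ne v
      exact ⟨w, by simpa using hw⟩
    · rw [coe_compl, coe_singleton]
      exact hG.connected.induce_compl_singleton_of_degree_eq_one h

lemma mem_subtreeFinset {s : Finset V} : s ∈ subtreeFinset G ↔ G.IsSubtree s := by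
  simp [subtreeFinset]

lemma filter_leaf_subtreeFinset :
    (subtreeFinset G).filter (fun s => ∃ v, G.degree v = 1 ∧ s = {v}) =
      G.leafFinset.map ⟨singleton, singleton_injective⟩ := by
  ext s
  simp only [Finset.mem_filter, mem_subtreeFinset, Finset.mem_map, mem_leafFinset,
    Function.Embedding.coeFn_mk]
  constructor
  · rintro ⟨-, v, hv, rfl⟩
    exact ⟨v, hv, rfl⟩
  · rintro ⟨v, hv, rfl⟩
    exact ⟨isSubtree_singleton v, v, hv, rfl⟩

lemma card_subtreeFinset' :
    ((subtreeFinset' G).card : ℚ) = (subtreeFinset G).card + 1 - G.leafFinset.card := by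
  have h := card_filter_add_card_filter_not (s := subtreeFinset G)
    (fun s => ∃ v, G.degree v = 1 ∧ s = {v})
  rw [filter_leaf_subtreeFinset, card_map] at h
  rw [subtreeFinset', card_insert_of_notMem, ← h]
  · push_cast
    ring
  · simp [mem_subtreeFinset, IsSubtree]

lemma sum_card_subtreeFinset' :
    ∑ s ∈ subtreeFinset' G, (s.card : ℚ) =
      ∑ s ∈ subtreeFinset G, (s.card : ℚ) - G.leafFinset.card := by
  have h := sum_filter_add_sum_filter_not (subtreeFinset G)
    (fun s => ∃ v, G.degree v = 1 ∧ s = {v}) (fun s => (s.card : ℚ))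
  rw [filter_leaf_subtreeFinset, sum_map] at h
  rw [subtreeFinset', sum_insert, ← h]
  · simp
  · simp [mem_subtreeFinset, IsSubtree]

/-- The subtrees with one vertex, with all vertices but one, and with all vertices. -/
noncomputable def extremalSubtreeFinset (G : SimpleGraph V) : Finset (Finset V) :=
  univ.image singleton ∪ (G.leafFinset.image (fun v => {v}ᶜ) ∪ {univ})

lemma sum_extremalSubtreeFinset (hn : 4 ≤ Fintype.card V) (f : ℕ → ℚ) :
    ∑ s ∈ G.extremalSubtreeFinset, f s.card =
      Fintype.card V * f 1 + (G.leafFinset.card * f (Fintype.card V - 1) +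
        f (Fintype.card V)) := by
  have hc (v : V) : ({v}ᶜ : Finset V).card = Fintype.card V - 1 := by
    rw [card_compl, card_singleton]
  rw [extremalSubtreeFinset, sum_union, sum_union, sum_image, sum_image]
  · simp [hc]
  · intro v _ w _ h
    simpa using h
  · intro v _ w _ h
    simpa using h
  · simp only [disjoint_singleton_right, Finset.mem_image, not_exists, not_and]
    intro v _ h
    have := hc v
    rw [h, card_univ] at this
    omega
  · rw [Finset.disjoint_left]
    intro s hs hs'
    obtain ⟨v, -, rfl⟩ := Finset.mem_image.mp hs
    rcases Finset.mem_union.mp hs' with h | h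
    · obtain ⟨w, -, hw⟩ := Finset.mem_image.mp h
      have := hc w
      rw [hw, card_singleton] at this
      omega
    · have := congrArg Finset.card (Finset.mem_singleton.mp h)
      rw [card_singleton, card_univ] at this
      omega

lemma IsTree.extremalSubtreeFinset_subset (hG : G.IsTree) (hn : 2 ≤ Fintype.card V) :
    G.extremalSubtreeFinset ⊆ subtreeFinset G := by
  intro s hs
  rw [mem_subtreeFinset]
  simp only [extremalSubtreeFinset, Finset.mem_union, Finset.mem_image, Finset.mem_singleton,
    Finset.mem_univ, true_and] at hs
  rcases hs with ⟨v, rfl⟩ | ⟨v, hv, rfl⟩ | rfl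
  · exact isSubtree_singleton v
  · exact (hG.isSubtree_compl_singleton_iff hn).mpr hv
  · exact hG.connected.isSubtree_univ

lemma two_le_card_of_notMem_extremalSubtreeFinset {s : Finset V} (hs : G.IsSubtree s)
    (hs' : s ∉ G.extremalSubtreeFinset) : 2 ≤ s.card := by
  by_contra h
  have h1 : s.card = 1 := by
    have := hs.1.card_pos
    omega
  obtain ⟨v, rfl⟩ := card_eq_one.mp h1
  exact hs' (by simp [extremalSubtreeFinset])

lemma IsTree.card_add_two_le_of_notMem_extremalSubtreeFinset (hG : G.IsTree)
    (hn : 2 ≤ Fintype.card V) {s : Finset V} (hs : G.IsSubtree s)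
    (hs' : s ∉ G.extremalSubtreeFinset) : s.card + 2 ≤ Fintype.card V := by
  by_contra h
  have hle := card_compl_add_card s
  have : sᶜ.card = 0 ∨ sᶜ.card = 1 := by omega
  rcases this with h0 | h1
  · rw [card_eq_zero, compl_eq_empty_iff] at h0
    exact hs' (by simp [extremalSubtreeFinset, h0])
  · obtain ⟨v, hv⟩ := card_eq_one.mp h1
    obtain rfl : s = {v}ᶜ := by rw [← hv, compl_compl]
    have := (hG.isSubtree_compl_singleton_iff hn).mp hs
    exact hs' (by simp [extremalSubtreeFinset, this])

lemma IsTree.two_le_card_leafFinset (hG : G.IsTree) (hn : 2 ≤ Fintype.card V) :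
    2 ≤ G.leafFinset.card := by
  have : Nontrivial V := Fintype.one_lt_card_iff_nontrivial.mp hn
  obtain ⟨u, v, huv, hu, hv⟩ := hG.exists_ne_and_degree_eq_one
  exact one_lt_card.mpr ⟨u, mem_leafFinset.mpr hu, v, mem_leafFinset.mpr hv, huv⟩

/-- The excess of a subtree with `k` vertices in a tree with `l` leaves: the inequality between
the two means holds when the total excess is nonnegative. -/
def subtreeExcess (l k : ℕ) : ℚ := (l - 1) * (k - 1) - 1

lemma subtreeExcess_nonneg {l k : ℕ} (hl : 2 ≤ l) (hk : 2 ≤ k) : 0 ≤ subtreeExcess l k := by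
  have h1 : (2 : ℚ) ≤ l := by exact_mod_cast hl
  have h2 : (2 : ℚ) ≤ k := by exact_mod_cast hk
  unfold subtreeExcess
  nlinarith

lemma sum_subtreeExcess (l : ℕ) :
    ∑ s ∈ subtreeFinset G, subtreeExcess l s.card =
      (l - 1) * ∑ s ∈ subtreeFinset G, (s.card : ℚ) - l * (subtreeFinset G).card := by
  simp only [subtreeExcess, sum_sub_distrib, ← mul_sum, sum_const, nsmul_eq_mul]
  ring

lemma sum_extremal_subtreeExcess (hn : 4 ≤ Fintype.card V) :
    ∑ s ∈ G.extremalSubtreeFinset, subtreeExcess G.leafFinset.card s.card =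
      ((G.leafFinset.card : ℚ) ^ 2 - 1) * (Fintype.card V - 2) - (Fintype.card V + 2) := by
  rw [sum_extremalSubtreeFinset hn, subtreeExcess, subtreeExcess, subtreeExcess,
    Nat.cast_sub (by omega)]
  push_cast
  ring

lemma IsTree.sum_extremal_le (hG : G.IsTree) (hn : 4 ≤ Fintype.card V) :
    ∑ s ∈ G.extremalSubtreeFinset, subtreeExcess G.leafFinset.card s.card ≤
      ∑ s ∈ subtreeFinset G, subtreeExcess G.leafFinset.card s.card :=
  sum_le_sum_of_subset_of_nonneg (hG.extremalSubtreeFinset_subset (by omega)) fun _ hs hs' =>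
    subtreeExcess_nonneg (hG.two_le_card_leafFinset (by omega))
      (two_le_card_of_notMem_extremalSubtreeFinset (mem_subtreeFinset.mp hs) hs')

lemma IsTree.sum_subtreeExcess_nonneg (hG : G.IsTree) (hn : 4 ≤ Fintype.card V) :
    0 ≤ ∑ s ∈ subtreeFinset G, subtreeExcess G.leafFinset.card s.card := by
  have h := hG.sum_extremal_le hn
  rw [sum_extremal_subtreeExcess hn] at h
  have h1 : (2 : ℚ) ≤ G.leafFinset.card := by
    exact_mod_cast hG.two_le_card_leafFinset (by omega)
  have h2 : (4 : ℚ) ≤ Fintype.card V := by exact_mod_cast hn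
  have h3 : (3 : ℚ) ≤ (G.leafFinset.card : ℚ) ^ 2 - 1 := by nlinarith
  nlinarith

lemma IsTree.sum_subtreeExcess_eq_zero_iff (hG : G.IsTree) (hn : 4 ≤ Fintype.card V) :
    ∑ s ∈ subtreeFinset G, subtreeExcess G.leafFinset.card s.card = 0 ↔
      Fintype.card V = 4 ∧ G.leafFinset.card = 2 := by
  constructor
  · intro h0
    have h := hG.sum_extremal_le hn
    rw [sum_extremal_subtreeExcess hn, h0] at h
    have hl := hG.two_le_card_leafFinset (by omega)
    have h1 : (2 : ℚ) ≤ G.leafFinset.card := by exact_mod_cast hl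
    have h2 : (4 : ℚ) ≤ Fintype.card V := by exact_mod_cast hn
    have h3 : (3 : ℚ) ≤ (G.leafFinset.card : ℚ) ^ 2 - 1 := by nlinarith
    have hn4 : (Fintype.card V : ℚ) ≤ 4 := by nlinarith
    have hl2 : (G.leafFinset.card : ℚ) < 3 := by
      by_contra! h4
      nlinarith
    have hn4' : Fintype.card V ≤ 4 := by exact_mod_cast hn4
    have hl2' : G.leafFinset.card < 3 := by exact_mod_cast hl2
    omega
  · rintro ⟨hV, hl⟩
    have h := sum_extremal_subtreeExcess (G := G) hn
    rw [hV, hl] at h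
    rw [hl, ← sum_subset (hG.extremalSubtreeFinset_subset (by omega)), h]
    · norm_num
    · intro s hs hs'
      rw [mem_subtreeFinset] at hs
      have h1 := two_le_card_of_notMem_extremalSubtreeFinset hs hs'
      have h2 := hG.card_add_two_le_of_notMem_extremalSubtreeFinset (by omega) hs hs'
      obtain h3 : s.card = 2 := by omega
      norm_num [subtreeExcess, h3]

lemma nonempty_iso_pathGraph_four {a b c d : V} (huniv : (univ : Finset V) = {a, b, c, d})
    (hcard : Fintype.card V = 4) (hab : G.Adj a b) (hbc : G.Adj b c) (hcd : G.Adj c d)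
    (hac : ¬ G.Adj a c) (hbd : ¬ G.Adj b d) (had : ¬ G.Adj a d) :
    Nonempty (G ≃g pathGraph 4) := by
  have hsurj : Function.Surjective ![a, b, c, d] := by
    intro v
    have hv : v ∈ ({a, b, c, d} : Finset V) := huniv ▸ mem_univ v
    simp only [Finset.mem_insert, Finset.mem_singleton] at hv
    rcases hv with rfl | rfl | rfl | rfl
    exacts [⟨0, rfl⟩, ⟨1, rfl⟩, ⟨2, rfl⟩, ⟨3, rfl⟩]
  have hbij : Function.Bijective ![a, b, c, d] :=
    (Fintype.bijective_iff_surjective_and_card _).mpr ⟨hsurj, by simp [hcard]⟩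
  refine ⟨RelIso.symm ⟨Equiv.ofBijective _ hbij, ?_⟩⟩
  intro i j
  fin_cases i <;> fin_cases j <;>
    simp [pathGraph_adj, hab, hbc, hcd, hac, hbd, had, hab.symm, hbc.symm, hcd.symm,
      G.adj_comm c a, G.adj_comm d b, G.adj_comm d a]

lemma IsTree.nonempty_iso_pathGraph_four_of_card (hG : G.IsTree) (hn : Fintype.card V = 4)
    (hl : G.leafFinset.card = 2) : Nonempty (G ≃g pathGraph 4) := by
  obtain ⟨a, d, had, hleaf⟩ := card_eq_two.mp hl
  obtain ⟨b, c, hbc, hinner⟩ := card_eq_two.mp (show G.leafFinsetᶜ.card = 2 by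
    rw [card_compl]; omega)
  have hb : b ∉ G.leafFinset := by rw [← mem_compl, hinner]; simp
  have hc : c ∉ G.leafFinset := by rw [← mem_compl, hinner]; simp
  have ha : a ∈ G.leafFinset := by rw [hleaf]; simp
  have hd : d ∈ G.leafFinset := by rw [hleaf]; simp
  have hab : a ≠ b := fun h => hb (h ▸ ha)
  have hac : a ≠ c := fun h => hc (h ▸ ha)
  have hbd : b ≠ d := fun h => hb (h ▸ hd)
  have hcd : c ≠ d := fun h => hc (h ▸ hd)
  have huniv : (univ : Finset V) = {a, b, c, d} := by
    rw [← union_compl G.leafFinset, hleaf] at *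
    rw [hinner]
    ext v
    simp only [Finset.mem_union, Finset.mem_insert, Finset.mem_singleton]
    tauto
  have hdeg (v : V) : G.degree v = (if G.Adj v a then 1 else 0) + ((if G.Adj v b then 1 else 0) +
      ((if G.Adj v c then 1 else 0) + (if G.Adj v d then 1 else 0))) := by
    rw [← card_neighborFinset_eq_degree, neighborFinset_eq_filter, card_filter, huniv,
      sum_insert (by simp [*]), sum_insert (by simp [*]), sum_insert (by simp [*]), sum_singleton]
  have : Nontrivial V := Fintype.one_lt_card_iff_nontrivial.mp (by omega)
  have hpos (v : V) : 0 < G.degree v := hG.connected.preconnected.degree_pos_of_nontrivial v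
  have hbpos := hpos b
  have hcpos := hpos c
  rw [mem_leafFinset, hdeg] at ha hb hc hd
  rw [hdeg] at hbpos hcpos
  simp only [G.irrefl, G.adj_comm b a, G.adj_comm c a, G.adj_comm d a, G.adj_comm c b,
    G.adj_comm d b, G.adj_comm d c, if_false] at ha hb hc hd hbpos hcpos
  by_cases h1 : G.Adj a b <;> by_cases h2 : G.Adj a c <;> by_cases h3 : G.Adj a d <;>
    by_cases h4 : G.Adj b c <;> by_cases h5 : G.Adj b d <;> by_cases h6 : G.Adj c d <;>
    simp only [h1, h2, h3, h4, h5, h6, if_true, if_false] at ha hb hc hd hbpos hcpos <;>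
    first
    | omega
    | exact absurd trivial hb
    | exact absurd trivial hc
    | exact nonempty_iso_pathGraph_four huniv hn h1 h4 h6 h2 h5 h3
    | exact nonempty_iso_pathGraph_four (by rw [huniv, insert_comm b c]) hn h2 h4.symm h5
        h1 h6 h3

lemma card_leafFinset_of_iso (e : G ≃g pathGraph 4) : G.leafFinset.card = 2 := by
  have hdeg (i : Fin 4) : (pathGraph 4).degree i = if i = 0 ∨ i = 3 then 1 else 2 := by
    rw [← card_neighborFinset_eq_degree, neighborFinset_eq_filter, card_filter, Fin.sum_univ_four]
    fin_cases i <;> simp [pathGraph_adj]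
  have : G.leafFinset.map e.toEquiv.toEmbedding = {0, 3} := by
    ext i
    obtain ⟨v, rfl⟩ := e.surjective i
    have hv : G.degree v = (pathGraph 4).degree (e v) := (e.degree_eq v).symm
    rw [hdeg] at hv
    rw [show e v = e.toEquiv.toEmbedding v from rfl, Finset.mem_map', mem_leafFinset, hv]
    simp [or_iff_not_imp_left]
  rw [← card_map e.toEquiv.toEmbedding, this]
  simp

end SimpleGraph

/-- For any tree `T` with at least four vertices, `μ(T) ≤ μ'(T)`, with equality if
and only if `T` is isomorphic to the path on four vertices. -/
theorem mu_le_mu' {V : Type*} [Fintype V] (G : SimpleGraph V) (hT : G.IsTree)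
    (hn : 4 ≤ Fintype.card V) :
    mu G ≤ mu' G ∧ (mu G = mu' G ↔ Nonempty (G ≃g SimpleGraph.pathGraph 4)) := by
  have hpos : (0 : ℚ) < (subtreeFinset G).card := by
    exact_mod_cast card_pos.mpr ⟨univ, mem_subtreeFinset.mpr hT.connected.isSubtree_univ⟩
  have hpos' : (0 : ℚ) < (subtreeFinset' G).card := by
    exact_mod_cast card_pos.mpr ⟨∅, mem_insert_self _ _⟩
  have hexcess := sum_subtreeExcess (G := G) G.leafFinset.card
  have hnonneg := hT.sum_subtreeExcess_nonneg hn
  have hzero := hT.sum_subtreeExcess_eq_zero_iff hn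
  rw [hexcess] at hnonneg hzero
  rw [mu, mu', div_le_div_iff₀ hpos hpos', div_eq_div_iff hpos.ne' hpos'.ne',
    sum_card_subtreeFinset', card_subtreeFinset']
  refine ⟨by linarith, ?_⟩
  trans Fintype.card V = 4 ∧ G.leafFinset.card = 2
  · rw [← hzero]
    constructor <;> intro h <;> linarith
  · constructor
    · rintro ⟨h4, h2⟩
      exact hT.nonempty_iso_pathGraph_four_of_card h4 h2
    · rintro ⟨e⟩
      exact ⟨by simpa using Fintype.card_congr e.toEquiv, card_leafFinset_of_iso e⟩
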